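/- The second and fourth Appell functions are related by the quadratic transformation: F₂[a₁, a₂, b; 2a₁, 2a₂; z₁, z₂] = (1 − z₁/2 − z₂/2)^{−b} · F₄[b/2, b/2 + 1/2; a₁ + 1/2, a₂ + 1/2; z₁²/(2−z₁−z₂)², z₂²/(2−z₁−z₂)²], valid for z₁, z₂ in a neighborhood of the origin where both series converge. -/

import Mathlib

noncomputable def pochC (p : ℂ) (k : ℕ) : ℂ := (ascPochhammer ℂ k).eval p

/-- The second Appell hypergeometric double series. -/
noncomputable def appellF2 (a₁ a₂ b c₁ c₂ z₁ z₂ : ℂ) : ℂ :=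
  ∑' m : ℕ × ℕ,
    pochC a₁ m.1 * pochC a₂ m.2 * pochC b (m.1 + m.2) / (pochC c₁ m.1 * pochC c₂ m.2) *
      (z₁ ^ m.1 / (m.1.factorial : ℂ)) * (z₂ ^ m.2 / (m.2.factorial : ℂ))

/-- The fourth Appell hypergeometric double series. -/
noncomputable def appellF4 (a b c₁ c₂ z₁ z₂ : ℂ) : ℂ :=
  ∑' m : ℕ × ℕ,
    pochC a (m.1 + m.2) * pochC b (m.1 + m.2) / (pochC c₁ m.1 * pochC c₂ m.2) *
      (z₁ ^ m.1 / (m.1.factorial : ℂ)) * (z₂ ^ m.2 / (m.2.factorial : ℂ))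

section

open Filter Topology Finset

theorem pochC_zero (p : ℂ) : pochC p 0 = 1 := by simp [pochC]

theorem pochC_succ (p : ℂ) (k : ℕ) : pochC p (k + 1) = pochC p k * (p + k) :=
  ascPochhammer_succ_eval k p

theorem pochC_ne_zero {p : ℂ} (hp : ∀ n : ℕ, p ≠ -(n : ℂ)) (k : ℕ) : pochC p k ≠ 0 := by
  induction k with
  | zero => simp [pochC_zero]
  | succ k ih =>
    rw [pochC_succ]
    exact mul_ne_zero ih fun h => hp k (eq_neg_of_add_eq_zero_left h)

theorem pochC_add (p : ℂ) (m n : ℕ) : pochC p (m + n) = pochC p m * pochC (p + m) n := by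
  induction n with
  | zero => simp [pochC_zero]
  | succ n ih =>
    rw [← add_assoc, pochC_succ, pochC_succ, ih]
    push_cast
    ring

theorem pochC_two_mul (p : ℂ) (k : ℕ) :
    pochC p (2 * k) = 4 ^ k * pochC (p / 2) k * pochC (p / 2 + 1 / 2) k := by
  induction k with
  | zero => simp [pochC_zero]
  | succ k ih =>
    rw [show 2 * (k + 1) = 2 * k + 1 + 1 by ring, pochC_succ, pochC_succ, pochC_succ, pochC_succ, ih]
    push_cast
    ring

/-- The binomial series. -/
theorem hasSum_pochC_cpow (c : ℂ) {w : ℂ} (hw : ‖w‖ < 1) :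
    HasSum (fun n : ℕ => pochC c n / n.factorial * w ^ n) ((1 - w) ^ (-c)) := by
  have h := (Complex.one_div_one_sub_cpow_hasFPowerSeriesOnBall_zero c).hasSum (y := w)
    (by rw [← ENNReal.ofReal_one, Metric.eball_ofReal]; simpa using hw)
  rw [zero_add, one_div, ← Complex.cpow_neg] at h
  refine h.congr_fun fun n => ?_
  have hn : (n.factorial : ℂ) ≠ 0 := Nat.cast_ne_zero.2 (Nat.factorial_ne_zero _)
  have hm : (n.factorial : ℂ) * Ring.choose (c + n - 1) n = pochC c n := by
    have := Ring.factorial_nsmul_multichoose_eq_ascPochhammer c n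
    rw [Polynomial.ascPochhammer_smeval_eq_eval, nsmul_eq_mul] at this
    rw [Ring.choose, show c + n - 1 - n + 1 = c by ring, this, pochC]
  rw [← hm]
  simp [FormalMultilinearSeries.ofScalars, hn, mul_comm]

theorem tendsto_norm_add_natCast_div (c : ℂ) :
    Tendsto (fun n : ℕ => ‖c + n‖ / (n + 1)) atTop (𝓝 1) := by
  have h : Tendsto (fun n : ℕ => ‖(c - 1) * (1 / ((n : ℂ) + 1)) + 1‖) atTop (𝓝 1) := by
    have := ((tendsto_one_div_add_atTop_nhds_zero_nat (𝕜 := ℂ)).const_mul (c - 1)).add_const 1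
    simpa using this.norm
  refine h.congr fun n => ?_
  have hn : (n : ℂ) + 1 ≠ 0 := Nat.cast_add_one_ne_zero n
  rw [show (c - 1) * (1 / ((n : ℂ) + 1)) + 1 = (c + n) / (n + 1) by field_simp; ring, norm_div]
  congr 1
  exact_mod_cast Complex.norm_natCast (n + 1)

theorem summable_norm_pochC (b : ℂ) {s : ℝ} (hs₀ : 0 ≤ s) (hs : s < 1) :
    Summable fun n : ℕ => ‖pochC b n‖ / n.factorial * s ^ n := by
  have h := (tendsto_norm_add_natCast_div b).mul_const s
  rw [one_mul] at h
  obtain ⟨r, hsr, hr⟩ := exists_between hs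
  refine summable_of_ratio_norm_eventually_le hr ?_
  filter_upwards [h.eventually (eventually_le_nhds hsr)] with n hn
  rw [pochC_succ, Nat.factorial_succ, Real.norm_of_nonneg (by positivity),
    Real.norm_of_nonneg (by positivity)]
  calc _ = (‖b + n‖ / (n + 1) * s) * (‖pochC b n‖ / n.factorial * s ^ n) := by
        rw [norm_mul]; push_cast; field_simp; ring
    _ ≤ _ := by gcongr

theorem exists_inv_norm_pochC_le {c : ℂ} (hc : ∀ n : ℕ, c ≠ -(n : ℂ)) {r : ℝ} (hr : 1 < r) :
    ∃ C, 0 ≤ C ∧ ∀ n : ℕ, ‖(pochC c n)⁻¹‖ ≤ C * r ^ n / n.factorial := by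
  have hr₀ : 0 < r := by linarith
  have h := ((tendsto_norm_add_natCast_div c).inv₀ one_ne_zero).mul_const r⁻¹
  have hr' := inv_lt_one_of_one_lt₀ hr
  rw [inv_one, one_mul] at h
  obtain ⟨q, hsq, hq⟩ := exists_between hr'
  have hsum : Summable fun n : ℕ => n.factorial * ‖(pochC c n)⁻¹‖ * r⁻¹ ^ n := by
    refine summable_of_ratio_norm_eventually_le hq ?_
    filter_upwards [h.eventually (eventually_le_nhds hsq)] with n hn
    have hn' : ‖c + n‖ ≠ 0 := norm_ne_zero_iff.2 fun h => hc n (eq_neg_of_add_eq_zero_left h)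
    rw [pochC_succ, Nat.factorial_succ, mul_inv, Real.norm_of_nonneg (by positivity),
      Real.norm_of_nonneg (by positivity)]
    calc _ = ((‖c + n‖ / (n + 1))⁻¹ * r⁻¹) * (n.factorial * ‖(pochC c n)⁻¹‖ * r⁻¹ ^ n) := by
          rw [norm_mul, norm_inv (c + n), pow_succ]; push_cast; field_simp
      _ ≤ _ := by gcongr
  refine ⟨∑' n : ℕ, n.factorial * ‖(pochC c n)⁻¹‖ * r⁻¹ ^ n, tsum_nonneg fun n => by positivity,
    fun n => ?_⟩
  have := hsum.le_tsum n fun j _ => by positivity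
  rw [le_div_iff₀ (by positivity), ← div_le_iff₀ (by positivity)]
  refine le_trans (le_of_eq ?_) this
  rw [inv_pow]
  field_simp

/-- Expansion of `∑ f n (x + y) ^ n / n!` as a double series. -/
theorem summable_norm_and_tsum_add_pow_prod {f : ℕ → ℂ} {x y : ℂ}
    (h : Summable fun n : ℕ => ‖f n‖ / n.factorial * (‖x‖ + ‖y‖) ^ n) :
    (Summable fun m : ℕ × ℕ => ‖f (m.1 + m.2) * (x ^ m.1 / m.1.factorial) *
      (y ^ m.2 / m.2.factorial)‖) ∧
    ∑' m : ℕ × ℕ, f (m.1 + m.2) * (x ^ m.1 / m.1.factorial) * (y ^ m.2 / m.2.factorial) =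
      ∑' n, f n / n.factorial * (x + y) ^ n := by
  have key (𝕜 : Type) [Field 𝕜] [CharZero 𝕜] (g : ℕ → 𝕜) (u v : 𝕜) (n : ℕ) :
      ∑ m ∈ antidiagonal n, g (m.1 + m.2) * (u ^ m.1 / m.1.factorial) * (v ^ m.2 / m.2.factorial) =
        g n / n.factorial * (u + v) ^ n := by
    rw [(Commute.all u v).add_pow', Finset.mul_sum]
    refine Finset.sum_congr rfl fun m hm => ?_
    rw [HasAntidiagonal.mem_antidiagonal] at hm
    subst hm
    have h1 : ((m.1 + m.2).factorial : 𝕜) ≠ 0 := Nat.cast_ne_zero.2 (Nat.factorial_ne_zero _)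
    have h2 : (m.1.factorial : 𝕜) ≠ 0 := Nat.cast_ne_zero.2 (Nat.factorial_ne_zero _)
    have h3 : (m.2.factorial : 𝕜) ≠ 0 := Nat.cast_ne_zero.2 (Nat.factorial_ne_zero _)
    rw [nsmul_eq_mul, Nat.cast_add_choose]
    field_simp
  have hs : Summable fun m : ℕ × ℕ => ‖f (m.1 + m.2) * (x ^ m.1 / m.1.factorial) *
      (y ^ m.2 / m.2.factorial)‖ := by
    rw [← HasAntidiagonal.sigmaAntidiagonalEquivProd.summable_iff,
      summable_sigma_of_nonneg fun _ => by exact norm_nonneg _]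
    refine ⟨fun n => (hasSum_fintype _).summable, h.congr fun n => ?_⟩
    rw [← key ℝ (fun n => ‖f n‖), tsum_fintype]
    refine .trans ?_ (Finset.sum_coe_sort (HasAntidiagonal.antidiagonal n) fun m : ℕ × ℕ =>
      ‖f (m.1 + m.2) * (x ^ m.1 / m.1.factorial) * (y ^ m.2 / m.2.factorial)‖).symm
    simp
  refine ⟨hs, ?_⟩
  rw [← HasAntidiagonal.sigmaAntidiagonalEquivProd.tsum_eq, Summable.tsum_sigma']
  · refine tsum_congr fun n => ?_
    rw [← key ℂ f, tsum_fintype]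
    exact (Finset.sum_coe_sort (HasAntidiagonal.antidiagonal n) fun m : ℕ × ℕ =>
      f (m.1 + m.2) * (x ^ m.1 / m.1.factorial) * (y ^ m.2 / m.2.factorial))
  · exact fun n => (hasSum_fintype _).summable
  · exact HasAntidiagonal.sigmaAntidiagonalEquivProd.summable_iff.2 hs.of_norm

theorem tsum_pochC_cpow_prod (c : ℂ) {x y : ℂ} (h : ‖x‖ + ‖y‖ < 1) :
    ∑' m : ℕ × ℕ, pochC c (m.1 + m.2) * (x ^ m.1 / m.1.factorial) * (y ^ m.2 / m.2.factorial) =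
      (1 - x - y) ^ (-c) := by
  rw [(summable_norm_and_tsum_add_pow_prod (summable_norm_pochC c (by positivity) h)).2, sub_sub]
  exact (hasSum_pochC_cpow c ((norm_add_le x y).trans_lt h)).tsum_eq

/-- The coefficients of `exp (x / 2)`, extended by zero to negative indices. -/
noncomputable def halfExpCoeff (j : ℤ) : ℂ :=
  if 0 ≤ j then (1 / 2) ^ j.toNat / (j.toNat.factorial : ℂ) else 0

theorem halfExpCoeff_natCast (n : ℕ) : halfExpCoeff n = (1 / 2) ^ n / (n.factorial : ℂ) := by
  simp [halfExpCoeff]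

theorem halfExpCoeff_of_neg {j : ℤ} (hj : j < 0) : halfExpCoeff j = 0 := by
  simp [halfExpCoeff, hj]

theorem mul_halfExpCoeff (j : ℤ) : (j : ℂ) * halfExpCoeff j = halfExpCoeff (j - 1) / 2 := by
  rcases lt_trichotomy j 0 with hj | rfl | hj
  · rw [halfExpCoeff_of_neg hj, halfExpCoeff_of_neg (by omega)]; simp
  · rw [halfExpCoeff_of_neg (by omega : (0 : ℤ) - 1 < 0)]; simp
  · obtain ⟨n, rfl⟩ : ∃ n : ℕ, j = (n + 1 : ℕ) := ⟨(j - 1).toNat, by omega⟩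
    rw [show ((n + 1 : ℕ) : ℤ) - 1 = (n : ℕ) by push_cast; ring, halfExpCoeff_natCast,
      halfExpCoeff_natCast, Nat.factorial_succ]
    have : (n : ℂ) + 1 ≠ 0 := Nat.cast_add_one_ne_zero n
    push_cast
    field_simp
    ring

/-- The coefficient of `x ^ (2 * k)` in `₀F₁(; a + 1/2; x² / 16)`. -/
noncomputable def besselCoeff (a : ℂ) (k : ℕ) : ℂ :=
  (16 ^ k * pochC (a + 1 / 2) k * (k.factorial : ℂ))⁻¹

theorem besselCoeff_succ {a : ℂ} (ha : ∀ n : ℕ, a + 1 / 2 ≠ -(n : ℂ)) (k : ℕ) :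
    2 * (k + 1) * (2 * k + 1 + 2 * a) * besselCoeff a (k + 1) = besselCoeff a k / 4 := by
  have h1 : (k : ℂ) + 1 ≠ 0 := Nat.cast_add_one_ne_zero k
  have h2 := pochC_ne_zero ha k
  have h3 : a + 1 / 2 + k ≠ 0 := fun h => ha k (eq_neg_of_add_eq_zero_left h)
  have h4 : (k.factorial : ℂ) ≠ 0 := Nat.cast_ne_zero.2 (Nat.factorial_ne_zero _)
  rw [besselCoeff, besselCoeff, pochC_succ, Nat.factorial_succ,
    show 2 * (k : ℂ) + 1 + 2 * a = 2 * (a + 1 / 2 + k) by ring]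
  push_cast
  generalize a + 1 / 2 + (k : ℂ) = t at *
  field_simp
  ring

/-- The recurrence satisfied by the coefficients of `exp (x / 2) ₀F₁(; a + 1/2; x² / 16)`. -/
theorem sum_halfExpCoeff_recurrence {a : ℂ} (ha : ∀ n : ℕ, a + 1 / 2 ≠ -(n : ℂ)) (m N : ℕ) :
    ∑ k ∈ range (N + 1),
      ((m + 1) * (m + 2 * a) * (halfExpCoeff ((m + 1 : ℕ) - 2 * k) * besselCoeff a k) -
        (m + a) * (halfExpCoeff (m - 2 * k) * besselCoeff a k)) =
      -(halfExpCoeff (m - 1 - 2 * N) * besselCoeff a N / 4) := by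
  have expand (k : ℕ) :
      (m + 1) * (m + 2 * a) * (halfExpCoeff ((m + 1 : ℕ) - 2 * k) * besselCoeff a k) -
        (m + a) * (halfExpCoeff (m - 2 * k) * besselCoeff a k) =
      halfExpCoeff ((m + 1 : ℕ) - 2 * k) * (2 * k * (2 * k - 1 + 2 * a) * besselCoeff a k) -
        halfExpCoeff (m - 1 - 2 * k) * besselCoeff a k / 4 := by
    have e1 := mul_halfExpCoeff ((m + 1 : ℕ) - 2 * k)
    have e2 := mul_halfExpCoeff (m - 2 * k)
    rw [show ((m + 1 : ℕ) : ℤ) - 2 * k - 1 = m - 2 * k by push_cast; ring] at e1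
    rw [show (m : ℤ) - 2 * k - 1 = m - 1 - 2 * k by ring] at e2
    push_cast at e1 e2 ⊢
    generalize halfExpCoeff ((m : ℤ) + 1 - 2 * k) = E₀ at *
    generalize halfExpCoeff ((m : ℤ) - 2 * k) = E₁ at *
    generalize halfExpCoeff ((m : ℤ) - 1 - 2 * k) = E₂ at *
    linear_combination (m + 2 * k + 2 * a) * besselCoeff a k * e1 - besselCoeff a k / 2 * e2
  induction N with
  | zero => rw [sum_range_one, expand]; simp
  | succ N ih =>
    rw [sum_range_succ, ih, expand]
    have e := besselCoeff_succ ha N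
    rw [show ((m + 1 : ℕ) : ℤ) - 2 * (N + 1 : ℕ) = m - 1 - 2 * N by push_cast; ring]
    push_cast
    linear_combination halfExpCoeff ((m : ℤ) - 1 - 2 * N) * e

/-- Kummer's second transformation at the level of coefficients. -/
theorem kummer_coeff {a : ℂ} (h2a : ∀ n : ℕ, 2 * a ≠ -(n : ℂ))
    (ha : ∀ n : ℕ, a + 1 / 2 ≠ -(n : ℂ)) {m N : ℕ} (hm : m < 2 * N) :
    ∑ k ∈ range N, halfExpCoeff (m - 2 * k) * besselCoeff a k =
      pochC a m / (pochC (2 * a) m * (m.factorial : ℂ)) := by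
  obtain ⟨N, rfl⟩ : ∃ n, N = n + 1 := ⟨N - 1, by omega⟩
  induction m generalizing N with
  | zero =>
    rw [sum_range_succ', sum_eq_zero]
    · simp [halfExpCoeff, besselCoeff, pochC_zero]
    · intro k _
      rw [halfExpCoeff_of_neg (by push_cast; omega), zero_mul]
  | succ m ih =>
    have h := sum_halfExpCoeff_recurrence ha m N
    rw [halfExpCoeff_of_neg (by omega), sum_sub_distrib, ← mul_sum, ← mul_sum,
      ih N (by omega)] at h
    have h1 : (m : ℂ) + 1 ≠ 0 := Nat.cast_add_one_ne_zero m
    have h2 := pochC_ne_zero h2a m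
    have h3 : 2 * a + m ≠ 0 := fun h => h2a m (eq_neg_of_add_eq_zero_left h)
    have h4 : (m.factorial : ℂ) ≠ 0 := Nat.cast_ne_zero.2 (Nat.factorial_ne_zero _)
    rw [pochC_succ, pochC_succ, Nat.factorial_succ]
    refine mul_left_cancel₀ (mul_ne_zero h1 h3) ?_
    push_cast at h ⊢
    generalize (∑ k ∈ range (N + 1), halfExpCoeff ((m : ℤ) + 1 - 2 * k) * besselCoeff a k) = S at *
    trans (m + a) * (pochC a m / (pochC (2 * a) m * m.factorial))
    · linear_combination h
    · generalize 2 * a + (m : ℂ) = t at *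
      field_simp
      ring

theorem sum_range_choose_two_mul_le (m N : ℕ) : ∑ k ∈ range N, m.choose (2 * k) ≤ 2 ^ m := by
  have h1 : ∑ k ∈ range N, m.choose (2 * k) = ∑ i ∈ (range N).image (2 * ·), m.choose i := by
    rw [sum_image]
    intro x _ y _ h
    simpa using h
  rw [h1, ← Nat.sum_range_choose]
  refine (sum_le_sum_of_ne_zero ?_)
  intro i _ hi
  rw [mem_range]
  by_contra h
  exact hi (Nat.choose_eq_zero_of_lt (by omega))

theorem exists_sum_norm_kummer_le {a : ℂ} (ha : ∀ n : ℕ, a + 1 / 2 ≠ -(n : ℂ)) {r : ℝ}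
    (hr : 1 < r) :
    ∃ C, 0 ≤ C ∧ ∀ m N : ℕ, ∑ k ∈ range N, ‖halfExpCoeff (m - 2 * k) * besselCoeff a k‖ ≤
      C * r ^ m / m.factorial := by
  obtain ⟨C, hC, hb⟩ := exists_inv_norm_pochC_le ha hr
  refine ⟨C, hC, fun m N => ?_⟩
  have term (k : ℕ) : ‖halfExpCoeff (m - 2 * k) * besselCoeff a k‖ ≤
      C * r ^ m / m.factorial / 2 ^ m * m.choose (2 * k) := by
    rcases lt_or_ge m (2 * k) with h | h
    · rw [halfExpCoeff_of_neg (by omega)]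
      simp only [zero_mul, norm_zero]
      positivity
    obtain ⟨j, rfl⟩ := Nat.exists_eq_add_of_le h
    rw [show ((2 * k + j : ℕ) : ℤ) - 2 * k = (j : ℕ) by push_cast; ring, halfExpCoeff_natCast,
      besselCoeff, Nat.cast_add_choose, mul_inv, mul_inv, norm_mul, norm_mul, norm_mul]
    have hcb : ((2 * k).factorial : ℝ) ≤ 4 ^ k * k.factorial * k.factorial := by
      have h1 := Nat.centralBinom_le_four_pow k
      have h2 : (2 * k).factorial = k.centralBinom * k.factorial * k.factorial := by
        have := Nat.add_choose_mul_factorial_mul_factorial k k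
        rw [Nat.centralBinom, two_mul, this]
      rw [h2]
      exact_mod_cast Nat.mul_le_mul_right _ (Nat.mul_le_mul_right _ h1)
    have hk : r ^ k ≤ r ^ (2 * k + j) := pow_le_pow_right₀ hr.le (by omega)
    have hinv : (1 : ℝ) / (4 ^ k * k.factorial * k.factorial) ≤ 1 / (2 * k).factorial :=
      one_div_le_one_div_of_le (by positivity) hcb
    have hr₀ : 0 < r := by linarith
    simp only [norm_div, norm_pow, norm_inv, norm_one, RCLike.norm_ofNat, RCLike.norm_natCast]
    have hb' := hb k
    rw [norm_inv] at hb'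
    calc _ ≤ (1 / 2) ^ j / (j.factorial : ℝ) * ((16 ^ k)⁻¹ * (C * r ^ k / k.factorial) *
          (k.factorial : ℝ)⁻¹) := by gcongr
      _ = (1 / 2) ^ j / (j.factorial : ℝ) * ((4 ^ k)⁻¹ * (C * r ^ k) *
          (1 / (4 ^ k * k.factorial * k.factorial))) := by
          rw [show (16 : ℝ) = 4 * 4 by norm_num, mul_pow]; field_simp
      _ ≤ (1 / 2) ^ j / (j.factorial : ℝ) * ((4 ^ k)⁻¹ * (C * r ^ (2 * k + j)) *
          (1 / (2 * k).factorial)) := by gcongr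
      _ = _ := by
          rw [pow_add 2, pow_mul 2, one_div_pow]; norm_num; field_simp
  have hr₀ : 0 < r := by linarith
  calc _ ≤ ∑ k ∈ range N, C * r ^ m / m.factorial / 2 ^ m * m.choose (2 * k) :=
        sum_le_sum fun k _ => term k
    _ = C * r ^ m / m.factorial / 2 ^ m * (∑ k ∈ range N, m.choose (2 * k) : ℕ) := by
        push_cast; rw [mul_sum]
    _ ≤ C * r ^ m / m.factorial / 2 ^ m * 2 ^ m := by
        gcongr
        exact_mod_cast sum_range_choose_two_mul_le m N
    _ = _ := by field_simp

theorem halfExpCoeff_mul_eq_zero {a : ℂ} {m k : ℕ} (hk : k ∉ range (m + 1)) :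
    halfExpCoeff (m - 2 * k) * besselCoeff a k = 0 := by
  rw [mem_range] at hk
  rw [halfExpCoeff_of_neg (by omega), zero_mul]

theorem hasSum_prod_of_ne_finset_zero {𝕜 : Type*} [Field 𝕜] [TopologicalSpace 𝕜] {f g : ℕ → 𝕜}
    {s t : Finset ℕ} (hf : ∀ k ∉ s, f k = 0) (hg : ∀ k ∉ t, g k = 0) :
    HasSum (fun k : ℕ × ℕ => f k.1 * g k.2) ((∑ k ∈ s, f k) * ∑ k ∈ t, g k) := by
  rw [sum_mul_sum, ← sum_product']
  refine hasSum_sum_of_ne_finset_zero fun k hk => ?_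
  rw [mem_product, not_and_or] at hk
  rcases hk with hk | hk
  · rw [hf _ hk, zero_mul]
  · rw [hg _ hk, mul_zero]

/-- The general term of the fourfold series interpolating between the two Appell series. -/
noncomputable def appellTerm (a₁ a₂ b z₁ z₂ : ℂ) (m k : ℕ × ℕ) : ℂ :=
  pochC b (m.1 + m.2) * z₁ ^ m.1 * z₂ ^ m.2 *
    ((halfExpCoeff (m.1 - 2 * k.1) * besselCoeff a₁ k.1) *
      (halfExpCoeff (m.2 - 2 * k.2) * besselCoeff a₂ k.2))

theorem summable_appellTerm {a₁ a₂ b z₁ z₂ : ℂ} (ha₁ : ∀ n : ℕ, a₁ + 1 / 2 ≠ -(n : ℂ))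
    (ha₂ : ∀ n : ℕ, a₂ + 1 / 2 ≠ -(n : ℂ)) (hz : ‖z₁‖ + ‖z₂‖ < 1) :
    Summable (Function.uncurry (appellTerm a₁ a₂ b z₁ z₂)) := by
  obtain ⟨r, hr, hrz⟩ : ∃ r : ℝ, 1 < r ∧ r * (‖z₁‖ + ‖z₂‖) < 1 := by
    have h : Tendsto (fun r : ℝ => r * (‖z₁‖ + ‖z₂‖)) (𝓝[>] 1) (𝓝 (1 * (‖z₁‖ + ‖z₂‖))) :=
      (tendsto_id.mono_left nhdsWithin_le_nhds).mul_const _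
    rw [one_mul] at h
    exact (eventually_mem_nhdsWithin.and (h.eventually (eventually_lt_nhds hz))).exists
  have hr₀ : 0 < r := by linarith
  obtain ⟨C₁, hC₁, hb₁⟩ := exists_sum_norm_kummer_le ha₁ hr
  obtain ⟨C₂, hC₂, hb₂⟩ := exists_sum_norm_kummer_le ha₂ hr
  have hnorm (z : ℂ) : ‖(r : ℂ) * z‖ = r * ‖z‖ := by
    rw [norm_mul, Complex.norm_real, Real.norm_of_nonneg hr₀.le]
  have hs := (summable_norm_and_tsum_add_pow_prod (f := pochC b) (x := r * z₁) (y := r * z₂)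
    (summable_norm_pochC b (by positivity) (by rwa [hnorm, hnorm, ← mul_add]))).1
  have hsum (m : ℕ × ℕ) : HasSum (fun k => ‖appellTerm a₁ a₂ b z₁ z₂ m k‖)
      (‖pochC b (m.1 + m.2) * z₁ ^ m.1 * z₂ ^ m.2‖ *
        ((∑ k ∈ range (m.1 + 1), ‖halfExpCoeff (m.1 - 2 * k) * besselCoeff a₁ k‖) *
          ∑ k ∈ range (m.2 + 1), ‖halfExpCoeff (m.2 - 2 * k) * besselCoeff a₂ k‖)) := by
    have := (hasSum_prod_of_ne_finset_zero
      (f := fun k : ℕ => ‖halfExpCoeff (m.1 - 2 * k) * besselCoeff a₁ k‖)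
      (g := fun k : ℕ => ‖halfExpCoeff (m.2 - 2 * k) * besselCoeff a₂ k‖)
      (fun k hk => by rw [halfExpCoeff_mul_eq_zero hk, norm_zero])
      (fun k hk => by rw [halfExpCoeff_mul_eq_zero hk, norm_zero])).mul_left
        ‖pochC b (m.1 + m.2) * z₁ ^ m.1 * z₂ ^ m.2‖
    simpa only [appellTerm, norm_mul] using this
  refine .of_norm ?_
  rw [summable_prod_of_nonneg fun _ => norm_nonneg _]
  refine ⟨fun m => (hsum m).summable, (hs.mul_left (C₁ * C₂)).of_nonneg_of_le
    (fun m => tsum_nonneg fun _ => norm_nonneg _) fun m => ?_⟩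
  refine (hsum m).tsum_eq.le.trans ?_
  calc _ ≤ ‖pochC b (m.1 + m.2) * z₁ ^ m.1 * z₂ ^ m.2‖ *
        ((C₁ * r ^ m.1 / m.1.factorial) * (C₂ * r ^ m.2 / m.2.factorial)) := by
        gcongr
        · exact hb₁ _ _
        · exact hb₂ _ _
    _ = _ := by
        simp only [norm_mul, norm_div, norm_pow, RCLike.norm_natCast, Complex.norm_real,
          Real.norm_of_nonneg hr₀.le]
        ring

theorem tsum_appellTerm_right {a₁ a₂ : ℂ} (h2a₁ : ∀ n : ℕ, 2 * a₁ ≠ -(n : ℂ))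
    (h2a₂ : ∀ n : ℕ, 2 * a₂ ≠ -(n : ℂ)) (ha₁ : ∀ n : ℕ, a₁ + 1 / 2 ≠ -(n : ℂ))
    (ha₂ : ∀ n : ℕ, a₂ + 1 / 2 ≠ -(n : ℂ)) (b z₁ z₂ : ℂ) (m : ℕ × ℕ) :
    ∑' k, appellTerm a₁ a₂ b z₁ z₂ m k =
      pochC a₁ m.1 * pochC a₂ m.2 * pochC b (m.1 + m.2) /
        (pochC (2 * a₁) m.1 * pochC (2 * a₂) m.2) *
        (z₁ ^ m.1 / (m.1.factorial : ℂ)) * (z₂ ^ m.2 / (m.2.factorial : ℂ)) := by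
  have := ((hasSum_prod_of_ne_finset_zero
    (f := fun k : ℕ => halfExpCoeff (m.1 - 2 * k) * besselCoeff a₁ k)
    (g := fun k : ℕ => halfExpCoeff (m.2 - 2 * k) * besselCoeff a₂ k)
    (fun k hk => halfExpCoeff_mul_eq_zero hk)
    (fun k hk => halfExpCoeff_mul_eq_zero hk)).mul_left
      (pochC b (m.1 + m.2) * z₁ ^ m.1 * z₂ ^ m.2)).tsum_eq
  simp only [appellTerm]
  rw [this, kummer_coeff h2a₁ ha₁ (by omega), kummer_coeff h2a₂ ha₂ (by omega)]
  field_simp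

theorem tsum_appellTerm_left (a₁ a₂ b : ℂ) {z₁ z₂ : ℂ} (hz : ‖z₁‖ + ‖z₂‖ < 1) (k : ℕ × ℕ) :
    ∑' m, appellTerm a₁ a₂ b z₁ z₂ m k =
      z₁ ^ (2 * k.1) * z₂ ^ (2 * k.2) * besselCoeff a₁ k.1 * besselCoeff a₂ k.2 *
        pochC b (2 * (k.1 + k.2)) *
        (1 - z₁ / 2 - z₂ / 2) ^ (-(b + (2 * (k.1 + k.2) : ℕ))) := by
  have hz' : ‖z₁ / 2‖ + ‖z₂ / 2‖ < 1 := by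
    rw [norm_div, norm_div, RCLike.norm_ofNat]
    linarith [norm_nonneg z₁, norm_nonneg z₂]
  let e : ℕ × ℕ → ℕ × ℕ := fun j => (2 * k.1 + j.1, 2 * k.2 + j.2)
  have he : Function.Injective e := by
    intro x y h
    simpa [e, Prod.ext_iff] using h
  have hsupp : Function.support (fun m => appellTerm a₁ a₂ b z₁ z₂ m k) ⊆ Set.range e := by
    intro m hm
    by_cases h : 2 * k.1 ≤ m.1 ∧ 2 * k.2 ≤ m.2
    · exact ⟨(m.1 - 2 * k.1, m.2 - 2 * k.2), by ext <;> simp [e, h]⟩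
    · refine absurd ?_ hm
      rw [not_and_or, not_le, not_le] at h
      rcases h with h | h
      · simp [appellTerm, halfExpCoeff_of_neg (show (m.1 : ℤ) - 2 * k.1 < 0 by omega)]
      · simp [appellTerm, halfExpCoeff_of_neg (show (m.2 : ℤ) - 2 * k.2 < 0 by omega)]
  rw [← he.tsum_eq hsupp, ← tsum_pochC_cpow_prod _ hz', ← tsum_mul_left]
  refine tsum_congr fun j => ?_
  simp only [appellTerm, e]
  rw [show ((2 * k.1 + j.1 : ℕ) : ℤ) - 2 * k.1 = (j.1 : ℕ) by push_cast; ring,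
    show ((2 * k.2 + j.2 : ℕ) : ℤ) - 2 * k.2 = (j.2 : ℕ) by push_cast; ring,
    halfExpCoeff_natCast, halfExpCoeff_natCast,
    show 2 * k.1 + j.1 + (2 * k.2 + j.2) = 2 * (k.1 + k.2) + (j.1 + j.2) by ring, pochC_add]
  simp only [div_eq_mul_inv, mul_pow, one_mul, pow_add]
  ring

theorem appellF4_term_eq (a₁ a₂ b z₁ z₂ : ℂ) {w : ℂ} (hw : w ≠ 0) (k : ℕ × ℕ) :
    z₁ ^ (2 * k.1) * z₂ ^ (2 * k.2) * besselCoeff a₁ k.1 * besselCoeff a₂ k.2 *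
        pochC b (2 * (k.1 + k.2)) * w ^ (-(b + (2 * (k.1 + k.2) : ℕ))) =
      w ^ (-b) * (pochC (b / 2) (k.1 + k.2) * pochC (b / 2 + 1 / 2) (k.1 + k.2) /
        (pochC (a₁ + 1 / 2) k.1 * pochC (a₂ + 1 / 2) k.2) *
        ((z₁ ^ 2 / (2 * w) ^ 2) ^ k.1 / (k.1.factorial : ℂ)) *
        ((z₂ ^ 2 / (2 * w) ^ 2) ^ k.2 / (k.2.factorial : ℂ))) := by
  have h16 (n : ℕ) : (16 : ℂ) ^ n = 4 ^ n * 4 ^ n := by rw [← mul_pow]; norm_num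
  have h4 (n : ℕ) (w : ℂ) : ((2 * w) ^ 2) ^ n = 4 ^ n * w ^ (2 * n) := by
    rw [mul_pow, mul_pow, pow_mul]; norm_num
  rw [pochC_two_mul, neg_add, ← sub_eq_add_neg, Complex.cpow_sub _ _ hw, Complex.cpow_natCast,
    besselCoeff, besselCoeff, h16, h16, div_pow, div_pow, h4, h4, ← pow_mul, ← pow_mul, mul_add 2,
    pow_add, pow_add]
  have hk₁ : (4 : ℂ) ^ k.1 ≠ 0 := pow_ne_zero _ (by norm_num)
  have hk₂ : (4 : ℂ) ^ k.2 ≠ 0 := pow_ne_zero _ (by norm_num)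
  generalize w ^ (-b) = W, w ^ (2 * k.1) = w₁, w ^ (2 * k.2) = w₂, (4 : ℂ) ^ k.1 = f₁ at *
  generalize a₁ + 1 / 2 = c₁, a₂ + 1 / 2 = c₂, b / 2 = e
  generalize e + 1 / 2 = d
  generalize (4 : ℂ) ^ k.2 = f₂, z₁ ^ (2 * k.1) = x₁, z₂ ^ (2 * k.2) = x₂ at *
  simp only [div_eq_mul_inv, mul_inv]
  trans (f₁ * f₁⁻¹) * (f₂ * f₂⁻¹) * (W * (pochC e (k.1 + k.2) * pochC d (k.1 + k.2) *
    ((pochC c₁ k.1)⁻¹ * (pochC c₂ k.2)⁻¹) * (x₁ * (f₁⁻¹ * w₁⁻¹) * (k.1.factorial : ℂ)⁻¹) *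
    (x₂ * (f₂⁻¹ * w₂⁻¹) * (k.2.factorial : ℂ)⁻¹)))
  · ring
  · rw [mul_inv_cancel₀ hk₁, mul_inv_cancel₀ hk₂, one_mul, one_mul]

end

/-- Quadratic transformation relating the second and fourth Appell functions. -/
theorem appellF2_to_appellF4 (a₁ a₂ b z₁ z₂ : ℂ)
    (h2a₁ : ∀ n : ℕ, 2 * a₁ ≠ -(n : ℂ))
    (h2a₂ : ∀ n : ℕ, 2 * a₂ ≠ -(n : ℂ))
    (ha₁ : ∀ n : ℕ, a₁ + 1/2 ≠ -(n : ℂ))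
    (ha₂ : ∀ n : ℕ, a₂ + 1/2 ≠ -(n : ℂ))
    (hne : (2 : ℂ) - z₁ - z₂ ≠ 0)
    (hconv : ‖z₁‖ + ‖z₂‖ < 1)
    (hconv' : Real.sqrt ‖z₁ ^ 2 / (2 - z₁ - z₂) ^ 2‖ +
        Real.sqrt ‖z₂ ^ 2 / (2 - z₁ - z₂) ^ 2‖ < 1) :
    appellF2 a₁ a₂ b (2 * a₁) (2 * a₂) z₁ z₂ =
      (1 - z₁ / 2 - z₂ / 2) ^ (-b) *
        appellF4 (b / 2) (b / 2 + 1/2) (a₁ + 1/2) (a₂ + 1/2)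
          (z₁ ^ 2 / (2 - z₁ - z₂) ^ 2) (z₂ ^ 2 / (2 - z₁ - z₂) ^ 2) := by
  have hw : 1 - z₁ / 2 - z₂ / 2 ≠ 0 := fun h => hne (by linear_combination 2 * h)
  have hw2 : 2 - z₁ - z₂ = 2 * (1 - z₁ / 2 - z₂ / 2) := by ring
  rw [appellF2, appellF4, ← tsum_mul_left]
  simp only [← tsum_appellTerm_right h2a₁ h2a₂ ha₁ ha₂]
  rw [← (summable_appellTerm (b := b) ha₁ ha₂ hconv).tsum_comm]
  refine tsum_congr fun k => ?_
  rw [tsum_appellTerm_left a₁ a₂ b hconv, hw2]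
  exact appellF4_term_eq a₁ a₂ b z₁ z₂ hw k
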